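/- arXiv:1602.07456 — 2 statements merged into one kernel-verified Lean document; each statement's English description precedes it below -/
import Mathlib

section
/- Assume p is q²-separable, α₀, α₋, α₊ are all nonzero, and either q² ≠ 1 or deg p(z) ≤ 1. Then the pair (Ω, d) is a first-order differential calculus on A(p;q); that is, d satisfies the Leibniz rule and the density condition Ω = A(p;q)·d(A(p;q)) holds (every element of Ω is a finite sum Σᵢ aᵢ·d(bᵢ) with aᵢ, bᵢ ∈ A(p;q)). -/
noncomputable section

open Polynomial
open scoped Classical

namespace GWAPaper

variable (K : Type) [Field K]

/-- Defining relations of the generalized Weyl algebra `A(p;q)`; the generators are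
indexed by `Fin 4` with `0 ↦ x₊`, `1 ↦ x₋`, `2 ↦ z₊`, `3 ↦ z₋`. -/
inductive GWARel (q : K) (p : K[X]) :
    FreeAlgebra K (Fin 4) → FreeAlgebra K (Fin 4) → Prop
  | zz : GWARel q p (FreeAlgebra.ι K (2 : Fin 4) * FreeAlgebra.ι K (3 : Fin 4))
      (FreeAlgebra.ι K (3 : Fin 4) * FreeAlgebra.ι K (2 : Fin 4))
  | xpzp : GWARel q p (FreeAlgebra.ι K (0 : Fin 4) * FreeAlgebra.ι K (2 : Fin 4))
      (q⁻¹ • (FreeAlgebra.ι K (2 : Fin 4) * FreeAlgebra.ι K (0 : Fin 4)))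
  | xpzm : GWARel q p (FreeAlgebra.ι K (0 : Fin 4) * FreeAlgebra.ι K (3 : Fin 4))
      (q⁻¹ • (FreeAlgebra.ι K (3 : Fin 4) * FreeAlgebra.ι K (0 : Fin 4)))
  | xmzp : GWARel q p (FreeAlgebra.ι K (1 : Fin 4) * FreeAlgebra.ι K (2 : Fin 4))
      (q • (FreeAlgebra.ι K (2 : Fin 4) * FreeAlgebra.ι K (1 : Fin 4)))
  | xmzm : GWARel q p (FreeAlgebra.ι K (1 : Fin 4) * FreeAlgebra.ι K (3 : Fin 4))
      (q • (FreeAlgebra.ι K (3 : Fin 4) * FreeAlgebra.ι K (1 : Fin 4)))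
  | xpxm : GWARel q p (FreeAlgebra.ι K (0 : Fin 4) * FreeAlgebra.ι K (1 : Fin 4))
      (Polynomial.aeval (FreeAlgebra.ι K (2 : Fin 4) * FreeAlgebra.ι K (3 : Fin 4)) p)
  | xmxp : GWARel q p (FreeAlgebra.ι K (1 : Fin 4) * FreeAlgebra.ι K (0 : Fin 4))
      (Polynomial.aeval ((q ^ 2 : K) • (FreeAlgebra.ι K (3 : Fin 4) * FreeAlgebra.ι K (2 : Fin 4))) p)

/-- The generalized Weyl algebra `A(p;q)`. -/
abbrev GWA (q : K) (p : K[X]) : Type := RingQuot (GWARel K q p)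

/-- The images of the four generators in `A(p;q)`. -/
def gwaGen (q : K) (p : K[X]) (i : Fin 4) : GWA K q p :=
  RingQuot.mkAlgHom K (GWARel K q p) (FreeAlgebra.ι K i)

/-- The generator `x₊`. -/
def xp (q : K) (p : K[X]) : GWA K q p := gwaGen K q p 0
/-- The generator `x₋`. -/
def xm (q : K) (p : K[X]) : GWA K q p := gwaGen K q p 1
/-- The generator `z₊`. -/
def zp (q : K) (p : K[X]) : GWA K q p := gwaGen K q p 2
/-- The generator `z₋`. -/
def zm (q : K) (p : K[X]) : GWA K q p := gwaGen K q p 3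

/-- ℤ-degrees of the generators: `deg x₊ = deg z₊ = 1`, `deg x₋ = deg z₋ = -1`. -/
def gwaWt : Fin 4 → ℤ := ![1, -1, 1, -1]

/-- The total degree of a word in the generators. -/
def wordDeg (w : List (Fin 4)) : ℤ := (w.map gwaWt).sum

/-- The product in `A(p;q)` of the letters of a word. -/
def wordVal (q : K) (p : K[X]) (w : List (Fin 4)) : GWA K q p :=
  (w.map (gwaGen K q p)).prod

/-- The degree-`n` homogeneous component of the ℤ-graded algebra `A(p;q)`:
the `K`-linear span of the values of all words of total degree `n`. -/
def component (q : K) (p : K[X]) (n : ℤ) : Submodule K (GWA K q p) :=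
  Submodule.span K {a | ∃ w : List (Fin 4), wordDeg w = n ∧ wordVal K q p w = a}

/-- The `q²`-derivative `p_{q²}` of a polynomial `p`, equal to
`(p(q²z) - p(z))/((q²-1)z)` if `q² ≠ 1` and to `p'` if `q² = 1`. -/
def qDeriv (q : K) (p : K[X]) : K[X] :=
  if q ^ 2 = 1 then derivative p
  else (p.comp (C (q ^ 2) * X) - p) / (C (q ^ 2 - 1) * X)

/-- The polynomial `c(z) = q·p_{q²}(z)`. -/
def cPoly (q : K) (p : K[X]) : K[X] := C q * qDeriv K q p

/-- `p` is `q²`-separable: `p(z)` is coprime with `z·p_{q²}(z)`. -/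
def QSeparable (q : K) (p : K[X]) : Prop := IsCoprime p (X * qDeriv K q p)

/-- The right `A(p;q)`-action on the free left module `Ω = A(p;q)³` with basis
`ω₋, ω₀, ω₊` (coordinates `0, 1, 2`), twisted by the automorphisms `σ₋ = σ₊` and `σ₀`:
`ω₋·a = σ₋(a)·ω₋`, `ω₀·a = σ₀(a)·ω₀`, `ω₊·a = σ₊(a)·ω₊`. -/
def rAct (q : K) (p : K[X]) (σm σ0 : GWA K q p ≃ₐ[K] GWA K q p)
    (ω : Fin 3 → GWA K q p) (a : GWA K q p) : Fin 3 → GWA K q p :=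
  ![ω 0 * σm a, ω 1 * σ0 a, ω 2 * σm a]


section GeneralFacts

variable {K} {A : Type*} [Ring A] [Algebra K A]

/-- An element intertwining `a` and `b` intertwines `f(a)` and `f(b)`. -/
theorem mul_aeval_of_mul_eq {x a b : A} (h : x * a = b * x) (f : K[X]) :
    x * aeval a f = aeval b f * x := by
  induction f using Polynomial.induction_on' with
  | add f g hf hg => simp [mul_add, add_mul, hf, hg]
  | monomial n r =>
    have hn : x * a ^ n = b ^ n * x := (show SemiconjBy x a b from h).pow_right n
    rw [aeval_monomial, aeval_monomial, ← mul_assoc, ← Algebra.commutes, mul_assoc, hn, mul_assoc]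

/-- `p(q²z) = p(z) + (q² - 1) z p_{q²}(z)`. -/
theorem comp_sq_mul_X (q : K) (p : K[X]) :
    p.comp (C (q ^ 2) * X) = p + C (q ^ 2 - 1) * (X * qDeriv K q p) := by
  unfold qDeriv
  split_ifs with h
  · simp [h]
  · have hne : q ^ 2 - 1 ≠ 0 := sub_ne_zero.mpr h
    have hX : (X : K[X]) ∣ p.comp (C (q ^ 2) * X) - p := by
      rw [X_dvd_iff, coeff_zero_eq_eval_zero]
      simp [eval_comp]
    have hdvd : C (q ^ 2 - 1) * X ∣ p.comp (C (q ^ 2) * X) - p :=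
      (IsUnit.mul_left_dvd (isUnit_C.mpr hne.isUnit)).mpr hX
    have := EuclideanDomain.mul_div_cancel' (mul_ne_zero (C_ne_zero.mpr hne) X_ne_zero) hdvd
    rw [← mul_assoc, this]
    ring

/-- Evaluation at `q²z` is evaluation of the rescaled polynomial at `z`. -/
theorem aeval_sq_smul (q : K) (a : A) (f : K[X]) :
    aeval ((q ^ 2 : K) • a) f = aeval a (f.comp (C (q ^ 2) * X)) := by
  rw [aeval_comp]
  simp [Algebra.smul_def]

/-- A left submodule of `A³` containing the three basis vectors is everything. -/
theorem eq_top_of_basis_mem {S : Submodule A (Fin 3 → A)} (h0 : ![1, 0, 0] ∈ S)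
    (h1 : ![0, 1, 0] ∈ S) (h2 : ![0, 0, 1] ∈ S) : S = ⊤ := by
  refine eq_top_iff.mpr fun v _ => ?_
  have hv : v = v 0 • ![1, 0, 0] + v 1 • ![0, 1, 0] + v 2 • ![0, 0, 1] := by
    ext i
    fin_cases i <;> simp
  rw [hv]
  exact S.add_mem (S.add_mem (S.smul_mem _ h0) (S.smul_mem _ h1)) (S.smul_mem _ h2)

end GeneralFacts

section Relations

variable {K} (q : K) (p : K[X])

theorem zp_mul_zm : zp K q p * zm K q p = zm K q p * zp K q p := by
  simpa [zp, zm, gwaGen] using RingQuot.mkAlgHom_rel K (GWARel.zz (q := q) (p := p))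

theorem xm_mul_zp : xm K q p * zp K q p = q • (zp K q p * xm K q p) := by
  simpa [zp, xm, gwaGen] using RingQuot.mkAlgHom_rel K (GWARel.xmzp (q := q) (p := p))

theorem xm_mul_zm : xm K q p * zm K q p = q • (zm K q p * xm K q p) := by
  simpa [zm, xm, gwaGen] using RingQuot.mkAlgHom_rel K (GWARel.xmzm (q := q) (p := p))

theorem xp_mul_xm : xp K q p * xm K q p = aeval (zp K q p * zm K q p) p := by
  have h := RingQuot.mkAlgHom_rel K (GWARel.xpxm (q := q) (p := p))
  rw [← aeval_algHom_apply] at h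
  simpa [xp, xm, zp, zm, gwaGen] using h

theorem xm_mul_xp :
    xm K q p * xp K q p = aeval ((q ^ 2 : K) • (zp K q p * zm K q p)) p := by
  have h := RingQuot.mkAlgHom_rel K (GWARel.xmxp (q := q) (p := p))
  rw [← aeval_algHom_apply] at h
  rw [zp_mul_zm]
  simpa [xp, xm, zp, zm, gwaGen] using h

theorem zm_mem_component : zm K q p ∈ component K q p (-1) :=
  Submodule.subset_span ⟨[3], by simp [wordDeg, gwaWt], by simp [wordVal, zm]⟩

theorem zp_mul_aeval (f : K[X]) :
    zp K q p * aeval (zp K q p * zm K q p) f = aeval (zp K q p * zm K q p) f * zp K q p :=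
  mul_aeval_of_mul_eq (by rw [mul_assoc, ← zp_mul_zm]) f

theorem zm_mul_aeval (f : K[X]) :
    zm K q p * aeval (zp K q p * zm K q p) f = aeval (zp K q p * zm K q p) f * zm K q p :=
  mul_aeval_of_mul_eq (by rw [← mul_assoc, ← zp_mul_zm]) f

theorem xm_mul_aeval (f : K[X]) :
    xm K q p * aeval (zp K q p * zm K q p) f
      = aeval ((q ^ 2 : K) • (zp K q p * zm K q p)) f * xm K q p :=
  mul_aeval_of_mul_eq (by
    rw [← mul_assoc, xm_mul_zp, smul_mul_assoc, mul_assoc, xm_mul_zm, mul_smul_comm, smul_smul,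
      smul_mul_assoc, mul_assoc, sq]) f

end Relations

/-- If `p` is `q²`-separable, `α₀, α₋, α₊ ≠ 0` and `q² ≠ 1` or
`deg p ≤ 1`, then `(Ω, d)` is a first-order differential calculus on `A(p;q)`:
`d` satisfies the Leibniz rule and the density condition `Ω = A(p;q)·d(A(p;q))`. -/
theorem first_order_calculus_on_A [CharZero K]
    (q : K) (hq : q ≠ 0) (p : K[X])
    (α0 αm αp : K)
    (σm : GWA K q p ≃ₐ[K] GWA K q p)
    (hσm : ∀ (n : ℤ) (a : GWA K q p), a ∈ component K q p n → σm a = q ^ n • a)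
    (σ0 : GWA K q p ≃ₐ[K] GWA K q p)
    (hσ0 : ∀ (n : ℤ) (a : GWA K q p), a ∈ component K q p n → σ0 a = q ^ (2 * n) • a)
    (D0 Dm Dp : GWA K q p →ₗ[K] GWA K q p)
    (hD0leib : ∀ a b, D0 (a * b) = D0 a * σ0 b + a * D0 b)
    (hD0xp : D0 (xp K q p) = α0 • xp K q p)
    (hD0xm : D0 (xm K q p) = -(q ^ (-2 : ℤ) * α0) • xm K q p)
    (hD0zp : D0 (zp K q p) = α0 • zp K q p)
    (hD0zm : D0 (zm K q p) = -(q ^ (-2 : ℤ) * α0) • zm K q p)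
    (hDmleib : ∀ a b, Dm (a * b) = Dm a * σm b + a * Dm b)
    (hDmxp : Dm (xp K q p) = 0)
    (hDmzp : Dm (zp K q p) = 0)
    (hDmxm : Dm (xm K q p) = αm • (aeval (zp K q p * zm K q p) (cPoly K q p) * zp K q p))
    (hDmzm : Dm (zm K q p) = αm • xp K q p)
    (hDpleib : ∀ a b, Dp (a * b) = Dp a * σm b + a * Dp b)
    (hDpxm : Dp (xm K q p) = 0)
    (hDpzm : Dp (zm K q p) = 0)
    (hDpxp : Dp (xp K q p) = αp • (aeval (zp K q p * zm K q p) (cPoly K q p) * zm K q p))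
    (hDpzp : Dp (zp K q p) = αp • xm K q p)
    (hsep : QSeparable K q p)
    (hα0 : α0 ≠ 0) (hαm : αm ≠ 0) (hαp : αp ≠ 0)
    (hq2 : q ^ 2 ≠ 1 ∨ p.natDegree ≤ 1) :
    (∀ a b : GWA K q p,
      (![Dm (a * b), D0 (a * b), Dp (a * b)] : Fin 3 → GWA K q p)
        = rAct K q p σm σ0 ![Dm a, D0 a, Dp a] b + a • ![Dm b, D0 b, Dp b]) ∧
    Submodule.span (GWA K q p)
      (Set.range fun a : GWA K q p => (![Dm a, D0 a, Dp a] : Fin 3 → GWA K q p)) = ⊤ := by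
  set S := Submodule.span (GWA K q p)
      (Set.range fun a : GWA K q p => (![Dm a, D0 a, Dp a] : Fin 3 → GWA K q p))
  set Z := zp K q p * zm K q p with hZ
  have hd (a : GWA K q p) : (![Dm a, D0 a, Dp a] : Fin 3 → GWA K q p) ∈ S :=
    Submodule.subset_span ⟨a, rfl⟩
  have hK (r : K) {v : Fin 3 → GWA K q p} (hv : v ∈ S) : r • v ∈ S := by
    rw [← algebraMap_smul (GWA K q p) r v]
    exact S.smul_mem _ hv
  have hcancel {r : K} (hr : r ≠ 0) {v : Fin 3 → GWA K q p} (hv : r • v ∈ S) : v ∈ S := by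
    simpa [inv_smul_smul₀ hr] using hK r⁻¹ hv
  refine ⟨fun a b => ?_, ?_⟩
  · ext i
    fin_cases i <;> simp [rAct, hDmleib, hD0leib, hDpleib]
  have hdxp := hd (xp K q p)
  have hdxm := hd (xm K q p)
  have hdzp := hd (zp K q p)
  have hdzm := hd (zm K q p)
  rw [hDmxp, hD0xp, hDpxp] at hdxp
  rw [hDmxm, hD0xm, hDpxm] at hdxm
  rw [hDmzp, hD0zp, hDpzp] at hdzp
  rw [hDmzm, hD0zm, hDpzm] at hdzm
  obtain ⟨u, v, huv⟩ := hsep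
  have hp0 : p.coeff 0 ≠ 0 := fun h => by
    have := congrArg (eval 0) huv
    simp [← coeff_zero_eq_eval_zero, h] at this
  -- the coefficient of `ω₀` obtained by eliminating `ω₊` between `x₋·dx₊` and `z₋·dz₊`
  set g : K[X] :=
    p.comp (C (q ^ 2) * X) - C q * (cPoly K q p).comp (C (q ^ 2) * X) * X with hg
  have hgω : (![0, aeval Z g, 0] : Fin 3 → GWA K q p) ∈ S := by
    have h := S.sub_mem (S.smul_mem (xm K q p) hdxp) (S.smul_mem
      (q • aeval ((q ^ 2 : K) • Z) (cPoly K q p) * zm K q p) hdzp)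
    refine hcancel hα0 ?_
    convert h using 1
    ext i
    fin_cases i
    · simp
    · have hcomm : aeval Z ((cPoly K q p).comp (C (q ^ 2) * X)) * (zm K q p * zp K q p)
          = aeval Z ((cPoly K q p).comp (C (q ^ 2) * X)) * Z := by rw [hZ, zp_mul_zm]
      simp only [Fin.mk_one, Matrix.cons_val, Pi.smul_apply, Pi.sub_apply, smul_eq_mul,
        mul_smul_comm, smul_mul_assoc, xm_mul_xp, aeval_sq_smul, ← hZ, mul_assoc, hcomm]
      simp only [hg, map_sub, map_mul, aeval_C, aeval_X, mul_assoc, ← Algebra.smul_def, smul_sub]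
    · simp only [Fin.reduceFinMk, Matrix.cons_val, Pi.smul_apply, Pi.sub_apply, smul_eq_mul,
        mul_smul_comm, smul_mul_assoc]
      rw [← mul_assoc, xm_mul_aeval, mul_assoc (aeval _ _) (xm K q p), xm_mul_zm]
      simp [← hZ, mul_assoc]
  have h1 : (![0, 1, 0] : Fin 3 → GWA K q p) ∈ S := by
    suffices h : (![0, algebraMap K _ (p.coeff 0), 0] : Fin 3 → GWA K q p) ∈ S by
      convert hK (p.coeff 0)⁻¹ h using 1
      simp [Algebra.algebraMap_eq_smul_one, inv_smul_smul₀ hp0]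
    by_cases hq1 : q ^ 2 = 1
    · have hdeg : p.natDegree ≤ 1 := hq2.resolve_left (not_not.mpr hq1)
      obtain ⟨a, b, rfl⟩ := exists_eq_X_add_C_of_natDegree_le_one hdeg
      have hgC : g = C b := by
        have hC : C q * C q = (1 : K[X]) := by rw [← C_mul, ← sq, hq1, C_1]
        have hgX : g = C a * X + C b - C q * C q * C a * X := by
          simp [hg, cPoly, qDeriv, hq1, mul_assoc]
        rw [hgX, hC]
        ring
      simpa [hgC] using hgω
    · have hne : q ^ (-2 : ℤ) ≠ 1 := by
        rw [zpow_neg, Ne, inv_eq_one]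
        exact_mod_cast hq1
      -- `z₋·dz₊ - dz₊·z₋` is a nonzero multiple of `z·ω₀`
      have hzω : (![0, Z, 0] : Fin 3 → GWA K q p) ∈ S := by
        have h := S.add_mem (S.sub_mem (S.smul_mem (zm K q p) hdzp) (hd Z))
          (S.smul_mem (zp K q p) hdzm)
        have hr : α0 * (1 - q ^ (-2 : ℤ)) ≠ 0 :=
          mul_ne_zero hα0 (sub_ne_zero.mpr hne.symm)
        refine hcancel hr ?_
        convert h using 1
        have hs := hσm _ _ (zm_mem_component q p)
        have hs0 := hσ0 _ _ (zm_mem_component q p)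
        rw [hZ, hDmleib, hD0leib, hDpleib, hDmzp, hD0zp, hDpzp, hDmzm, hD0zm, hDpzm, hs, hs0]
        ext i
        fin_cases i
        · simp
        · simp only [Fin.mk_one, Matrix.cons_val, Pi.smul_apply, Pi.add_apply, Pi.sub_apply,
            smul_eq_mul, mul_smul_comm, smul_mul_assoc, ← zp_mul_zm]
          norm_num
          module
        · have hqq : q ^ (-1 : ℤ) * αp * q = αp := by field_simp
          simp only [Fin.reduceFinMk, Matrix.cons_val, Pi.smul_apply, Pi.add_apply, Pi.sub_apply,
            smul_eq_mul, mul_smul_comm, smul_mul_assoc, xm_mul_zm, mul_zero, smul_zero,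
            smul_smul (q ^ (-1 : ℤ))]
          rw [smul_smul (q ^ (-1 : ℤ) * αp), hqq]
          simp
      have hdec : aeval Z g = aeval Z g.divX * Z + algebraMap K _ (p.coeff 0) := by
        conv_lhs => rw [← divX_mul_X_add g]
        simp [hg, coeff_zero_eq_eval_zero, eval_comp]
      convert S.sub_mem hgω (S.smul_mem (aeval Z g.divX) hzω) using 1
      simp [hdec]
  have hqC : C q⁻¹ * C q = (1 : K[X]) := by rw [← C_mul, inv_mul_cancel₀ hq, C_1]
  have hdvd : u * p + C (q⁻¹) * v * (cPoly K q p * X) = 1 := by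
    rw [← huv, cPoly]
    linear_combination (v * X * qDeriv K q p) * hqC
  have h2 : (![0, 0, 1] : Fin 3 → GWA K q p) ∈ S := by
    have hA := S.sub_mem hdzp (S.smul_mem (α0 • zp K q p) h1)
    have hB := S.sub_mem hdxp (S.smul_mem (α0 • xp K q p) h1)
    have h := S.add_mem (S.smul_mem (aeval Z u * xp K q p) hA)
      (S.smul_mem (aeval Z (C q⁻¹ * v) * zp K q p) hB)
    refine hcancel hαp ?_
    convert h using 1
    ext i
    fin_cases i
    · simp
    · simp
    · have hone := congrArg (aeval Z : K[X] →ₐ[K] GWA K q p) hdvd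
      rw [map_add, map_mul _ u, map_mul _ (C q⁻¹ * v), map_mul _ (cPoly K q p), map_one,
        aeval_X] at hone
      have hc : zp K q p * (aeval Z (cPoly K q p) * zm K q p) = aeval Z (cPoly K q p) * Z := by
        rw [← mul_assoc, zp_mul_aeval, mul_assoc]
      simp only [Fin.reduceFinMk, Matrix.cons_val, Pi.smul_apply, Pi.add_apply, Pi.sub_apply,
        smul_eq_mul, mul_smul_comm, mul_zero, sub_zero, mul_assoc, xp_mul_xm, ← hZ, hc]
      rw [← smul_add, ← hone]
  have hdvd' : u * p.comp (C (q ^ 2) * X)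
      + C (q⁻¹) * (v - C (q ^ 2 - 1) * u) * (cPoly K q p * X) = 1 := by
    rw [comp_sq_mul_X, ← huv, cPoly]
    linear_combination ((v - C (q ^ 2 - 1) * u) * X * qDeriv K q p) * hqC
  have h0 : (![1, 0, 0] : Fin 3 → GWA K q p) ∈ S := by
    have hA := S.add_mem hdzm (S.smul_mem ((q ^ (-2 : ℤ) * α0) • zm K q p) h1)
    have hB := S.add_mem hdxm (S.smul_mem ((q ^ (-2 : ℤ) * α0) • xm K q p) h1)
    have h := S.add_mem (S.smul_mem (aeval Z u * xm K q p) hA)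
      (S.smul_mem (aeval Z (C q⁻¹ * (v - C (q ^ 2 - 1) * u)) * zm K q p) hB)
    refine hcancel hαm ?_
    convert h using 1
    ext i
    fin_cases i
    · have hone := congrArg (aeval Z : K[X] →ₐ[K] GWA K q p) hdvd'
      rw [map_add, map_mul _ u, map_mul _ (C q⁻¹ * _), map_mul _ (cPoly K q p), map_one,
        aeval_X] at hone
      have hc : zm K q p * (aeval Z (cPoly K q p) * zp K q p) = aeval Z (cPoly K q p) * Z := by
        rw [← mul_assoc, zm_mul_aeval, mul_assoc, ← zp_mul_zm]
      simp only [Fin.zero_eta, Matrix.cons_val, Pi.smul_apply, Pi.add_apply,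
        smul_eq_mul, mul_smul_comm, mul_zero, add_zero, mul_assoc,
        xm_mul_xp, aeval_sq_smul, ← hZ, hc]
      rw [← smul_add, ← hone]
    · have hcanc (x : GWA K q p) :
          -(q ^ (-2 : ℤ) * α0) • x + (q ^ (-2 : ℤ) * α0) • x = 0 := by
        rw [← add_smul, neg_add_cancel, zero_smul]
      simp only [Fin.mk_one, Matrix.cons_val, Pi.smul_apply, Pi.add_apply, smul_eq_mul, mul_one,
        hcanc, mul_zero, smul_zero, add_zero]
    · simp
  exact eq_top_of_basis_mem h0 h1 h2

end GWAPaper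
end
end

section
/- Let p(z) = z² − 1 and assume q is not a root of unity and α₀, α₋, α₊ are nonzero. Then for all k ∈ ℕ the integral satisfies, in coker(div): [k+1]·Λ(z^k) = Λ(1) if k is even, and [k+1]·Λ(z^k) = [2]·Λ(z) if k is odd, where z = z₋z₊ and [l] = (1 − q^{2l})/(1 − q²). -/
noncomputable section

open Polynomial
open scoped Classical

namespace GWAPaper

variable (K : Type) [Field K]

/-- A right `A(p;q)`-module map `Ω → A(p;q)`, where `Ω` is the free left module
with basis `ω₋, ω₀, ω₊` and right action `rAct`. -/
structure OmegaRightHom (q : K) (p : K[X]) (σm σ0 : GWA K q p ≃ₐ[K] GWA K q p) : Type where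
  toFun : (Fin 3 → GWA K q p) → GWA K q p
  map_add' : ∀ ω η, toFun (ω + η) = toFun ω + toFun η
  map_rmul' : ∀ ω a, toFun (rAct K q p σm σ0 ω a) = toFun ω * a

/-- The divergence associated with the calculus `(Ω, d)`:
`div(ξ) = q⁻²·∂₋(ξ(ω₋)) + ∂₀(ξ(ω₀)) + q²·∂₊(ξ(ω₊))`. -/
def divMap (q : K) (p : K[X]) (σm σ0 : GWA K q p ≃ₐ[K] GWA K q p)
    (D0 Dm Dp : GWA K q p →ₗ[K] GWA K q p) (ξ : OmegaRightHom K q p σm σ0) : GWA K q p :=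
  q ^ (-2 : ℤ) • Dm (ξ.toFun ![1, 0, 0]) + D0 (ξ.toFun ![0, 1, 0]) + q ^ 2 • Dp (ξ.toFun ![0, 0, 1])

/-- The image of the divergence, as a `K`-subspace of `A(p;q)`. -/
def imDiv (q : K) (p : K[X]) (σm σ0 : GWA K q p ≃ₐ[K] GWA K q p)
    (D0 Dm Dp : GWA K q p →ₗ[K] GWA K q p) : Submodule K (GWA K q p) :=
  Submodule.span K (Set.range (divMap K q p σm σ0 D0 Dm Dp))


section WeylRelations

variable {K} {A : Type*} [Ring A] [Algebra K A]

lemma mul_pow_of_mul_eq_smul {r : K} {x z : A} (h : x * z = r • (z * x)) (k : ℕ) :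
    x * z ^ k = r ^ k • (z ^ k * x) := by
  induction k with
  | zero => simp
  | succ k ih =>
    rw [pow_succ, ← mul_assoc, ih, smul_mul_assoc, mul_assoc, h, mul_smul_comm, smul_smul,
      pow_succ, mul_assoc]

variable {q a : K} {xp xm zp zm : A} {σ : A →ₐ[K] A} {D : A →ₗ[K] A}

/-- A twisted derivation killing `z₊` and sending `z₋` to a multiple of `x₊`, evaluated on the
powers of `z₋z₊` and multiplied by `x₋z₋`. -/
lemma twistedDerivation_pow_mul (hq : q ≠ 0)
    (hzz : zp * zm = zm * zp) (hxpzp : xp * zp = q⁻¹ • (zp * xp))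
    (hxpzm : xp * zm = q⁻¹ • (zm * xp))
    (hxpxm : xp * xm = (zp * zm) ^ 2 - 1)
    (hσzp : σ zp = q • zp) (hσzm : σ zm = q⁻¹ • zm)
    (hD : ∀ a b, D (a * b) = D a * σ b + a * D b)
    (hDzp : D zp = 0) (hDzm : D zm = a • xp) (k : ℕ) :
    D ((zm * zp) ^ k) * (xm * zm) =
      (a * ∑ i ∈ Finset.range k, (q⁻¹ ^ 2) ^ i) • ((zm * zp) ^ k * ((zm * zp) ^ 2 - 1)) := by
  have hσz : σ (zm * zp) = zm * zp := by
    rw [map_mul, hσzp, hσzm, smul_mul_smul_comm, inv_mul_cancel₀ hq, one_smul]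
  have hxz : xp * (zm * zp) = (q⁻¹ ^ 2) • ((zm * zp) * xp) := by
    rw [← mul_assoc, hxpzm, smul_mul_assoc, mul_assoc, hxpzp, mul_smul_comm, smul_smul,
      sq, mul_assoc]
  have hDz : D (zm * zp) = a • (zp * xp) := by
    rw [hD, hDzp, hDzm, hσzp, mul_zero, add_zero, smul_mul_smul_comm, hxpzp, smul_smul, mul_assoc,
      mul_inv_cancel₀ hq, mul_one]
  have hcp : Commute zp (zm * zp) := by
    rw [Commute, SemiconjBy, ← mul_assoc, hzz]
  have hcm : Commute zm (zm * zp) := by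
    rw [Commute, SemiconjBy, ← hzz, ← mul_assoc, hzz]
  induction k with
  | zero =>
    have h1 : D 1 = 0 := by simpa using hD 1 1
    simp [h1]
  | succ k ih =>
    have key : zp * xp * (zm * zp) ^ k * (xm * zm) =
        (q⁻¹ ^ 2) ^ k • ((zm * zp) ^ (k + 1) * ((zm * zp) ^ 2 - 1)) := by
      calc zp * xp * (zm * zp) ^ k * (xm * zm)
          = zp * (xp * (zm * zp) ^ k) * (xm * zm) := by simp only [mul_assoc]
        _ = (q⁻¹ ^ 2) ^ k • (zp * (zm * zp) ^ k * (xp * xm) * zm) := by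
          rw [mul_pow_of_mul_eq_smul hxz]
          simp only [mul_assoc, mul_smul_comm, smul_mul_assoc]
        _ = (q⁻¹ ^ 2) ^ k • ((zm * zp) ^ (k + 1) * ((zm * zp) ^ 2 - 1)) := by
          rw [hxpxm, hzz, (hcp.pow_right k).eq, mul_assoc, ← ((hcm.pow_right 2).sub_right
            (Commute.one_right zm)).eq, ← mul_assoc, mul_assoc _ zp zm, hzz, ← pow_succ]
    rw [pow_succ', hD, map_pow, hσz, add_mul, mul_assoc (zm * zp) (D _), ih, hDz, smul_mul_assoc,
      smul_mul_assoc, key, Finset.sum_range_succ, mul_smul_comm, ← mul_assoc (zm * zp), ← pow_succ',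
      smul_smul, ← add_smul]
    congr 1
    ring

/-- The relation between `z ^ (k + 2)` and `z ^ k` produced by a twisted derivation. -/
lemma twistedDerivation_pow_mul_eq (hq : q ≠ 0) (hq2 : q ^ 2 ≠ 1)
    (hzz : zp * zm = zm * zp) (hxpzp : xp * zp = q⁻¹ • (zp * xp))
    (hxpzm : xp * zm = q⁻¹ • (zm * xp))
    (hxpxm : xp * xm = (zp * zm) ^ 2 - 1) (hxmxp : xm * xp = (q ^ 2 • (zm * zp)) ^ 2 - 1)
    (hσxm : σ xm = q⁻¹ • xm) (hσzp : σ zp = q • zp) (hσzm : σ zm = q⁻¹ • zm)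
    (hD : ∀ a b, D (a * b) = D a * σ b + a * D b)
    (hDzp : D zp = 0) (hDzm : D zm = a • xp)
    (hDxm : D xm = a • ((q * (q ^ 2 + 1)) • (zp * zm) * zp)) (k : ℕ) :
    q ^ (2 * k) • D ((zm * zp) ^ k * (xm * zm)) =
      a • (((1 - q ^ (2 * (k + 3))) / (1 - q ^ 2)) • (zm * zp) ^ (k + 2)
        - ((1 - q ^ (2 * (k + 1))) / (1 - q ^ 2)) • (zm * zp) ^ k) := by
  have hDxz : D (xm * zm) = a • ((q ^ 4 + q ^ 2 + 1) • (zm * zp) ^ 2 - 1) := by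
    have hqq : q⁻¹ * (a * (q * (q ^ 2 + 1))) = a * (q ^ 2 + 1) := by field_simp
    rw [hD, hDzm, hDxm, hσzm, mul_smul_comm, mul_smul_comm, hxmxp, smul_mul_assoc, smul_mul_assoc,
      smul_mul_assoc, mul_assoc (zp * zm), hzz, ← sq, smul_smul a, smul_smul, hqq, _root_.smul_pow]
    module
  have hσ : σ (xm * zm) = (q⁻¹ ^ 2) • (xm * zm) := by
    rw [map_mul, hσxm, hσzm, smul_mul_smul_comm, sq]
  rw [hD, hσ, mul_smul_comm, twistedDerivation_pow_mul hq hzz hxpzp hxpzm hxpxm hσzp hσzm hD hDzp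
    hDzm, hDxz, mul_smul_comm, mul_sub, mul_sub, mul_smul_comm, ← pow_add, mul_one]
  have hr' : 1 - q ^ 2 ≠ 0 := sub_ne_zero.2 hq2.symm
  have hs : q ^ (2 * k) * (q⁻¹ ^ 2 * ∑ i ∈ Finset.range k, (q⁻¹ ^ 2) ^ i) =
      (1 - q ^ (2 * k)) / (1 - q ^ 2) := by
    have h1 := geom_sum_mul (q⁻¹ ^ 2) k
    have h2 : q ^ (2 * k) * (q⁻¹ ^ 2) ^ k = 1 := by
      rw [pow_mul, ← mul_pow, ← mul_pow, mul_inv_cancel₀ hq, one_pow, one_pow]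
    have h3 : q ^ 2 * q⁻¹ ^ 2 = 1 := by rw [← mul_pow, mul_inv_cancel₀ hq, one_pow]
    rw [eq_div_iff hr']
    linear_combination q ^ (2 * k) * h1 + h2 -
      q ^ (2 * k) * (∑ i ∈ Finset.range k, (q⁻¹ ^ 2) ^ i) * h3
  set s := ∑ i ∈ Finset.range k, (q⁻¹ ^ 2) ^ i
  have h1 : (1 - q ^ (2 * (k + 1))) / (1 - q ^ 2) = q ^ (2 * k) * (q⁻¹ ^ 2 * s) + q ^ (2 * k) := by
    rw [hs]; field_simp; ring
  have h3 : (1 - q ^ (2 * (k + 3))) / (1 - q ^ 2) =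
      q ^ (2 * k) * (q⁻¹ ^ 2 * s) + q ^ (2 * k) * (q ^ 4 + q ^ 2 + 1) := by
    rw [hs]; field_simp; ring
  rw [h1, h3]
  module

end WeylRelations

lemma gwaGen_mem_component (q : K) (p : K[X]) (i : Fin 4) :
    gwaGen K q p i ∈ component K q p (gwaWt i) :=
  Submodule.subset_span ⟨[i], by simp [wordDeg], by simp [wordVal]⟩

lemma cPoly_X_sq_sub_one {q : K} (hq2 : q ^ 2 ≠ 1) :
    cPoly K q (X ^ 2 - 1) = C (q * (q ^ 2 + 1)) * X := by
  have hne : C (q ^ 2 - 1) * X ≠ (0 : K[X]) :=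
    mul_ne_zero (C_ne_zero.2 (sub_ne_zero.2 hq2)) X_ne_zero
  have hmul : ((X ^ 2 - 1 : K[X]).comp (C (q ^ 2) * X) - (X ^ 2 - 1)) =
      C (q ^ 2 - 1) * X * (C (q ^ 2 + 1) * X) := by
    simp only [sub_comp, pow_comp, X_comp, one_comp, map_sub, map_add, map_pow, map_one]
    ring
  rw [cPoly, qDeriv, if_neg hq2, hmul, mul_div_cancel_left₀ _ hne, C_mul, mul_assoc]

/-- Every value of `∂₋` is a divergence. -/
lemma Dm_mem_imDiv {q : K} (hq : q ≠ 0) (p : K[X]) (σm σ0 : GWA K q p ≃ₐ[K] GWA K q p)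
    (D0 Dm Dp : GWA K q p →ₗ[K] GWA K q p) (u : GWA K q p) :
    Dm u ∈ imDiv K q p σm σ0 D0 Dm Dp := by
  let ξ : OmegaRightHom K q p σm σ0 :=
    { toFun := fun ω => u * σm.symm (ω 0)
      map_add' := fun ω η => by simp [mul_add]
      map_rmul' := fun ω a => by simp [rAct, mul_assoc] }
  have h : divMap K q p σm σ0 D0 Dm Dp ξ = q ^ (-2 : ℤ) • Dm u := by
    simp [divMap, ξ]
  have hmem : divMap K q p σm σ0 D0 Dm Dp ξ ∈ imDiv K q p σm σ0 D0 Dm Dp :=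
    Submodule.subset_span ⟨ξ, rfl⟩
  rw [h] at hmem
  exact (Submodule.smul_mem_iff _ (zpow_ne_zero _ hq)).1 hmem

/-- For `p(z) = z² − 1` and `q` not a root of unity the integral
satisfies `[k+1]·Λ(z^k) = Λ(1)` for even `k` and `[k+1]·Λ(z^k) = [2]·Λ(z)` for odd `k`. -/
theorem integral_example_one [CharZero K]
    (q : K) (hq : q ≠ 0) (p : K[X])
    (hp : p = X ^ 2 - 1)
    (α0 αm αp : K)
    (σm : GWA K q p ≃ₐ[K] GWA K q p)
    (hσm : ∀ (n : ℤ) (a : GWA K q p), a ∈ component K q p n → σm a = q ^ n • a)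
    (σ0 : GWA K q p ≃ₐ[K] GWA K q p)
    (hσ0 : ∀ (n : ℤ) (a : GWA K q p), a ∈ component K q p n → σ0 a = q ^ (2 * n) • a)
    (D0 Dm Dp : GWA K q p →ₗ[K] GWA K q p)
    (hD0leib : ∀ a b, D0 (a * b) = D0 a * σ0 b + a * D0 b)
    (hD0xp : D0 (xp K q p) = α0 • xp K q p)
    (hD0xm : D0 (xm K q p) = -(q ^ (-2 : ℤ) * α0) • xm K q p)
    (hD0zp : D0 (zp K q p) = α0 • zp K q p)
    (hD0zm : D0 (zm K q p) = -(q ^ (-2 : ℤ) * α0) • zm K q p)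
    (hDmleib : ∀ a b, Dm (a * b) = Dm a * σm b + a * Dm b)
    (hDmxp : Dm (xp K q p) = 0)
    (hDmzp : Dm (zp K q p) = 0)
    (hDmxm : Dm (xm K q p) = αm • (aeval (zp K q p * zm K q p) (cPoly K q p) * zp K q p))
    (hDmzm : Dm (zm K q p) = αm • xp K q p)
    (hDpleib : ∀ a b, Dp (a * b) = Dp a * σm b + a * Dp b)
    (hDpxm : Dp (xm K q p) = 0)
    (hDpzm : Dp (zm K q p) = 0)
    (hDpxp : Dp (xp K q p) = αp • (aeval (zp K q p * zm K q p) (cPoly K q p) * zm K q p))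
    (hDpzp : Dp (zp K q p) = αp • xm K q p)
    (hqru : ∀ n : ℕ, q ^ n = 1 → n = 0)
    (hα0 : α0 ≠ 0) (hαm : αm ≠ 0) (hαp : αp ≠ 0) :
    ∀ k : ℕ,
      (Even k →
        ((1 - q ^ (2 * (k + 1))) / (1 - q ^ 2)) •
            (imDiv K q p σm σ0 D0 Dm Dp).mkQ ((zm K q p * zp K q p) ^ k)
          = (imDiv K q p σm σ0 D0 Dm Dp).mkQ 1) ∧
      (Odd k →
        ((1 - q ^ (2 * (k + 1))) / (1 - q ^ 2)) •
            (imDiv K q p σm σ0 D0 Dm Dp).mkQ ((zm K q p * zp K q p) ^ k)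
          = ((1 - q ^ 4) / (1 - q ^ 2)) • (imDiv K q p σm σ0 D0 Dm Dp).mkQ (zm K q p * zp K q p)) := by
  subst hp
  have hq2 : q ^ 2 ≠ 1 := fun h => absurd (hqru 2 h) two_ne_zero
  have hr : 1 - q ^ 2 ≠ 0 := sub_ne_zero.2 hq2.symm
  have hσxm : σm (xm K q (X ^ 2 - 1)) = q⁻¹ • xm K q (X ^ 2 - 1) := by
    simpa [gwaWt, xm] using hσm _ _ (gwaGen_mem_component K q (X ^ 2 - 1) 1)
  have hσzp : σm (zp K q (X ^ 2 - 1)) = q • zp K q (X ^ 2 - 1) := by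
    simpa [gwaWt, zp] using hσm _ _ (gwaGen_mem_component K q (X ^ 2 - 1) 2)
  have hσzm : σm (zm K q (X ^ 2 - 1)) = q⁻¹ • zm K q (X ^ 2 - 1) := by
    simpa [gwaWt, zm] using hσm _ _ (gwaGen_mem_component K q (X ^ 2 - 1) 3)
  have hzz : zp K q (X ^ 2 - 1) * zm K q (X ^ 2 - 1) = zm K q (X ^ 2 - 1) * zp K q (X ^ 2 - 1) := by
    simpa [zp, zm, gwaGen] using RingQuot.mkAlgHom_rel K (GWARel.zz (q := q) (p := X ^ 2 - 1))
  have hxpzp : xp K q (X ^ 2 - 1) * zp K q (X ^ 2 - 1) =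
      q⁻¹ • (zp K q (X ^ 2 - 1) * xp K q (X ^ 2 - 1)) := by
    simpa [zp, xp, gwaGen] using RingQuot.mkAlgHom_rel K (GWARel.xpzp (q := q) (p := X ^ 2 - 1))
  have hxpzm : xp K q (X ^ 2 - 1) * zm K q (X ^ 2 - 1) =
      q⁻¹ • (zm K q (X ^ 2 - 1) * xp K q (X ^ 2 - 1)) := by
    simpa [zm, xp, gwaGen] using RingQuot.mkAlgHom_rel K (GWARel.xpzm (q := q) (p := X ^ 2 - 1))
  have hxpxm : xp K q (X ^ 2 - 1) * xm K q (X ^ 2 - 1) =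
      (zp K q (X ^ 2 - 1) * zm K q (X ^ 2 - 1)) ^ 2 - 1 := by
    have h := RingQuot.mkAlgHom_rel K (GWARel.xpxm (q := q) (p := X ^ 2 - 1))
    rw [← aeval_algHom_apply, map_mul, map_mul] at h
    simpa only [map_sub, map_pow, aeval_X, map_one, xp, xm, zp, zm, gwaGen] using h
  have hxmxp : xm K q (X ^ 2 - 1) * xp K q (X ^ 2 - 1) =
      (q ^ 2 • (zm K q (X ^ 2 - 1) * zp K q (X ^ 2 - 1))) ^ 2 - 1 := by
    have h := RingQuot.mkAlgHom_rel K (GWARel.xmxp (q := q) (p := X ^ 2 - 1))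
    rw [← aeval_algHom_apply, map_smul, map_mul, map_mul] at h
    simpa only [map_sub, map_pow, aeval_X, map_one, xp, xm, zp, zm, gwaGen] using h
  rw [cPoly_X_sq_sub_one K hq2, map_mul, aeval_C, aeval_X, ← Algebra.smul_def] at hDmxm
  have step (k : ℕ) : ((1 - q ^ (2 * (k + 2 + 1))) / (1 - q ^ 2)) •
      (imDiv K q (X ^ 2 - 1) σm σ0 D0 Dm Dp).mkQ
        ((zm K q (X ^ 2 - 1) * zp K q (X ^ 2 - 1)) ^ (k + 2)) =
      ((1 - q ^ (2 * (k + 1))) / (1 - q ^ 2)) • (imDiv K q (X ^ 2 - 1) σm σ0 D0 Dm Dp).mkQ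
        ((zm K q (X ^ 2 - 1) * zp K q (X ^ 2 - 1)) ^ k) := by
    have h := twistedDerivation_pow_mul_eq (σ := (σm : _ →ₐ[K] _)) hq hq2 hzz hxpzp hxpzm hxpxm
      hxmxp hσxm hσzp hσzm hDmleib hDmzp hDmzm hDmxm k
    rw [← map_smul, ← map_smul, Submodule.mkQ_apply, Submodule.mkQ_apply, Submodule.Quotient.eq,
      ← Submodule.smul_mem_iff _ hαm, ← h]
    exact Submodule.smul_mem _ _ (Dm_mem_imDiv K hq _ _ _ _ _ _ _)
  intro k
  induction k using Nat.twoStepInduction with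
  | zero => simp [div_self hr]
  | one => simp
  | more k ih _ =>
    rw [step]
    simpa [Nat.even_add, Nat.odd_add] using ih

end GWAPaper
end
end
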